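/- Consider the series composition of two atomic congestion games: finite disjoint resource sets E_A and E_B with nonnegative, monotonically nondecreasing cost functions c_e : ℕ → ℝ; each player i has strategy set {a ∪ b : a ∈ 𝒜_i, b ∈ ℬ_i}, where 𝒜_i is a nonempty set of nonempty finite subsets of E_A and ℬ_i of E_B; congestions and costs are as in an atomic congestion game. Then a toll vector θ on E_A ∪ E_B implements the state with components (S_A, S_B) in the combined game if and only if the restriction of θ to E_A implements S_A in the congestion game on E_A with strategy sets 𝒜_i and the restriction of θ to E_B implements S_B in the congestion game on E_B with strategy sets ℬ_i. Consequently, (S_A, S_B) is implementable if and only if both S_A and S_B are, and in that case the minimum number of tolled edges needed to implement (S_A, S_B) equals the minimum for S_A plus the minimum for S_B. -/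

import Mathlib

/-- Congestion of resource `e` in state `S`: the number of players using `e`. -/
def cong {E : Type*} [DecidableEq E] {n : ℕ} (S : Fin n → Finset E) (e : E) : ℕ :=
  (Finset.univ.filter fun i => e ∈ S i).card

/-- A toll vector `θ` implements the state `S`: `S` is a pure Nash equilibrium of the
game with cost functions `c_e(x) + θ_e`, i.e. no player can strictly decrease their
tolled cost by unilaterally deviating to another of their strategies. -/
def Implements {E : Type*} [Fintype E] [DecidableEq E] (c : E → ℕ → ℝ) (θ : E → ℝ)
    {n : ℕ} (P : Fin n → Finset (Finset E)) (S : Fin n → Finset E) : Prop :=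
  ∀ i, ∀ Q ∈ P i,
    ∑ e ∈ S i, (c e (cong S e) + θ e) ≤
      ∑ e ∈ Q ∩ S i, (c e (cong S e) + θ e) + ∑ e ∈ Q \ S i, (c e (cong S e + 1) + θ e)

/-- The combined strategy `a ∪ b` in the series composition, viewed inside `EA ⊕ EB`. -/
def combStrat {EA EB : Type*} [DecidableEq EA] [DecidableEq EB]
    (a : Finset EA) (b : Finset EB) : Finset (EA ⊕ EB) :=
  a.map ⟨Sum.inl, Sum.inl_injective⟩ ∪ b.map ⟨Sum.inr, Sum.inr_injective⟩

theorem sum_combStrat {EA EB : Type*} [DecidableEq EA] [DecidableEq EB]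
    (a : Finset EA) (b : Finset EB) (f : EA ⊕ EB → ℝ) :
    ∑ e ∈ combStrat a b, f e = ∑ e ∈ a, f (Sum.inl e) + ∑ e ∈ b, f (Sum.inr e) := by
  rw [combStrat, Finset.sum_union, Finset.sum_map, Finset.sum_map]
  · rfl
  · simp [Finset.disjoint_left]

@[simp]
theorem inl_mem_combStrat {EA EB : Type*} [DecidableEq EA] [DecidableEq EB]
    {a : Finset EA} {b : Finset EB} {e : EA} : Sum.inl e ∈ combStrat a b ↔ e ∈ a := by
  simp [combStrat]

@[simp]
theorem inr_mem_combStrat {EA EB : Type*} [DecidableEq EA] [DecidableEq EB]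
    {a : Finset EA} {b : Finset EB} {e : EB} : Sum.inr e ∈ combStrat a b ↔ e ∈ b := by
  simp [combStrat]

theorem combStrat_inter {EA EB : Type*} [DecidableEq EA] [DecidableEq EB]
    (a a' : Finset EA) (b b' : Finset EB) :
    combStrat a b ∩ combStrat a' b' = combStrat (a ∩ a') (b ∩ b') := by
  ext (e | e) <;> simp

theorem combStrat_sdiff {EA EB : Type*} [DecidableEq EA] [DecidableEq EB]
    (a a' : Finset EA) (b b' : Finset EB) :
    combStrat a b \ combStrat a' b' = combStrat (a \ a') (b \ b') := by
  ext (e | e) <;> simp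

theorem cong_combStrat_inl {EA EB : Type*} [DecidableEq EA] [DecidableEq EB] {n : ℕ}
    (SA : Fin n → Finset EA) (SB : Fin n → Finset EB) (e : EA) :
    cong (fun i => combStrat (SA i) (SB i)) (Sum.inl e) = cong SA e := by
  simp [cong]

theorem cong_combStrat_inr {EA EB : Type*} [DecidableEq EA] [DecidableEq EB] {n : ℕ}
    (SA : Fin n → Finset EA) (SB : Fin n → Finset EB) (e : EB) :
    cong (fun i => combStrat (SA i) (SB i)) (Sum.inr e) = cong SB e := by
  simp [cong]

/-- A toll vector implements a state of the series composition iff its restrictions implement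
the components: a deviation in one component alone keeps the cost in the other one. -/
theorem implements_combStrat_iff {EA EB : Type*}
    [Fintype EA] [DecidableEq EA] [Fintype EB] [DecidableEq EB]
    {cA : EA → ℕ → ℝ} {cB : EB → ℕ → ℝ}
    {n : ℕ} {𝒜 : Fin n → Finset (Finset EA)} {ℬ : Fin n → Finset (Finset EB)}
    {SA : Fin n → Finset EA} {SB : Fin n → Finset EB}
    (hSA : ∀ i, SA i ∈ 𝒜 i) (hSB : ∀ i, SB i ∈ ℬ i) (θ : EA ⊕ EB → ℝ) :
    Implements (Sum.elim cA cB) θ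
        (fun i => (𝒜 i ×ˢ ℬ i).image fun ab => combStrat ab.1 ab.2)
        (fun i => combStrat (SA i) (SB i)) ↔
      Implements cA (fun e => θ (Sum.inl e)) 𝒜 SA ∧
      Implements cB (fun e => θ (Sum.inr e)) ℬ SB := by
  simp only [Implements, Finset.forall_mem_image, Finset.mem_product, Prod.forall, and_imp,
    combStrat_inter, combStrat_sdiff, sum_combStrat, cong_combStrat_inl, cong_combStrat_inr,
    Sum.elim_inl, Sum.elim_inr]
  refine ⟨fun h => ⟨fun i a ha => ?_, fun i b hb => ?_⟩, fun ⟨hA, hB⟩ i a b ha hb => ?_⟩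
  · have := h i a (SB i) ha (hSB i)
    simp only [Finset.inter_self, Finset.sdiff_self, Finset.sum_empty] at this
    linarith
  · have := h i (SA i) b (hSA i) hb
    simp only [Finset.inter_self, Finset.sdiff_self, Finset.sum_empty] at this
    linarith
  · linarith [hA i a ha, hB i b hb]

theorem card_filter_sum {α β : Type*} [Fintype α] [Fintype β] (p : α ⊕ β → Prop)
    [DecidablePred p] :
    (Finset.univ.filter p).card =
      (Finset.univ.filter fun a => p (Sum.inl a)).card +
        (Finset.univ.filter fun b => p (Sum.inr b)).card := by
  simp only [Finset.card_filter, Fintype.sum_sum_type]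

/-- Series composition of two atomic congestion games: disjoint resource sets `EA`, `EB`,
player `i` has strategies `{a ∪ b : a ∈ 𝒜 i, b ∈ ℬ i}`.  A toll vector `θ` on
`EA ⊕ EB` implements the state with components `(SA, SB)` iff its restriction to `EA`
implements `SA` (w.r.t. `𝒜`) and its restriction to `EB` implements `SB` (w.r.t. `ℬ`).
Consequently `(SA, SB)` is implementable iff both components are, and in that case the
minimum number of tolled edges for `(SA, SB)` is the sum of the two component minima. -/
theorem series_composition_tolls {EA EB : Type*}
    [Fintype EA] [DecidableEq EA] [Fintype EB] [DecidableEq EB]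
    (cA : EA → ℕ → ℝ) (cB : EB → ℕ → ℝ)
    (hcA : ∀ e k, 0 ≤ cA e k) (hcB : ∀ e k, 0 ≤ cB e k)
    (hmA : ∀ e, Monotone (cA e)) (hmB : ∀ e, Monotone (cB e))
    {n : ℕ} (𝒜 : Fin n → Finset (Finset EA)) (ℬ : Fin n → Finset (Finset EB))
    (h𝒜ne : ∀ i, (𝒜 i).Nonempty) (hℬne : ∀ i, (ℬ i).Nonempty)
    (h𝒜el : ∀ i, ∀ a ∈ 𝒜 i, a.Nonempty) (hℬel : ∀ i, ∀ b ∈ ℬ i, b.Nonempty)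
    (SA : Fin n → Finset EA) (SB : Fin n → Finset EB)
    (hSA : ∀ i, SA i ∈ 𝒜 i) (hSB : ∀ i, SB i ∈ ℬ i) :
    (∀ θ : EA ⊕ EB → ℝ, (∀ e, 0 ≤ θ e) →
      (Implements (Sum.elim cA cB) θ
          (fun i => (𝒜 i ×ˢ ℬ i).image fun ab => combStrat ab.1 ab.2)
          (fun i => combStrat (SA i) (SB i)) ↔
        Implements cA (fun e => θ (Sum.inl e)) 𝒜 SA ∧
        Implements cB (fun e => θ (Sum.inr e)) ℬ SB)) ∧
    ((∃ θ : EA ⊕ EB → ℝ, (∀ e, 0 ≤ θ e) ∧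
        Implements (Sum.elim cA cB) θ
          (fun i => (𝒜 i ×ˢ ℬ i).image fun ab => combStrat ab.1 ab.2)
          (fun i => combStrat (SA i) (SB i))) ↔
      (∃ θA : EA → ℝ, (∀ e, 0 ≤ θA e) ∧ Implements cA θA 𝒜 SA) ∧
      (∃ θB : EB → ℝ, (∀ e, 0 ≤ θB e) ∧ Implements cB θB ℬ SB)) ∧
    (∀ kA kB : ℕ,
      IsLeast {k : ℕ | ∃ θA : EA → ℝ, (∀ e, 0 ≤ θA e) ∧ Implements cA θA 𝒜 SA ∧
          (Finset.univ.filter fun e => 0 < θA e).card = k} kA →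
      IsLeast {k : ℕ | ∃ θB : EB → ℝ, (∀ e, 0 ≤ θB e) ∧ Implements cB θB ℬ SB ∧
          (Finset.univ.filter fun e => 0 < θB e).card = k} kB →
      IsLeast {k : ℕ | ∃ θ : EA ⊕ EB → ℝ, (∀ e, 0 ≤ θ e) ∧
          Implements (Sum.elim cA cB) θ
            (fun i => (𝒜 i ×ˢ ℬ i).image fun ab => combStrat ab.1 ab.2)
            (fun i => combStrat (SA i) (SB i)) ∧
          (Finset.univ.filter fun e => 0 < θ e).card = k} (kA + kB)) := by
  refine ⟨fun θ _ => implements_combStrat_iff hSA hSB θ, ⟨?_, ?_⟩, ?_⟩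
  · rintro ⟨θ, hθ, h⟩
    obtain ⟨hA, hB⟩ := (implements_combStrat_iff hSA hSB θ).1 h
    exact ⟨⟨_, fun e => hθ (Sum.inl e), hA⟩, ⟨_, fun e => hθ (Sum.inr e), hB⟩⟩
  · rintro ⟨⟨θA, hθA, hA⟩, ⟨θB, hθB, hB⟩⟩
    exact ⟨Sum.elim θA θB, Sum.forall.2 ⟨hθA, hθB⟩,
      (implements_combStrat_iff hSA hSB _).2 ⟨hA, hB⟩⟩
  · rintro kA kB ⟨⟨θA, hθA, hA, hkA⟩, hminA⟩ ⟨⟨θB, hθB, hB, hkB⟩, hminB⟩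
    refine ⟨⟨Sum.elim θA θB, Sum.forall.2 ⟨hθA, hθB⟩,
      (implements_combStrat_iff hSA hSB _).2 ⟨hA, hB⟩, ?_⟩, ?_⟩
    · rw [card_filter_sum, ← hkA, ← hkB]
      rfl
    · rintro k ⟨θ, hθ, h, rfl⟩
      obtain ⟨hA', hB'⟩ := (implements_combStrat_iff hSA hSB θ).1 h
      rw [card_filter_sum]
      exact add_le_add (hminA ⟨_, fun e => hθ (Sum.inl e), hA', rfl⟩)
        (hminB ⟨_, fun e => hθ (Sum.inr e), hB', rfl⟩)
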